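/- For every δ > 0 and every constant C > 0 there exist a constant C' > 0 and Q₀ such that the following holds for every prime q ≥ Q₀. Let L ≥ q^{3/2} and suppose: (i) #{1 ≤ n ≤ q : gcd(n,q) = 1, λ(n) ≠ χ_q(n)} ≤ C·q^{1-δ}; and (ii) λ(n + q) = λ(n) for every positive integer n ≤ L with gcd(n, q) = 1. Then for every N ≤ q, the number E(N) of primes p with N/2 ≤ p ≤ N and χ_q(p) = 1 satisfies E(N) ≤ C'·N·q^{-3δ/4}. -/

import Mathlib

open scoped BigOperators

/-- The Liouville function `λ(n) = (-1)^Ω(n)`. -/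
def liouville (n : ℕ) : ℤ := (-1) ^ (ArithmeticFunction.cardFactors n)

theorem liouville_mul {m n : ℕ} (hm : m ≠ 0) (hn : n ≠ 0) :
    liouville (m * n) = liouville m * liouville n := by
  simp [liouville, ArithmeticFunction.cardFactors_mul hm hn, pow_add]

theorem liouville_prime {p : ℕ} (hp : p.Prime) : liouville p = -1 := by
  simp [liouville, ArithmeticFunction.cardFactors_apply_prime hp]

theorem liouville_ne_zero (n : ℕ) : liouville n ≠ 0 := by
  simp [liouville]

theorem liouville_eq_jacobiSym_of_forall_prime_dvd {q n : ℕ} (hn : n ≠ 0)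
    (h : ∀ p : ℕ, p.Prime → p ∣ n → jacobiSym p q = -1) :
    liouville n = jacobiSym n q := by
  induction n using induction_on_primes with
  | zero => exact absurd rfl hn
  | one => simp [liouville]
  | prime_mul p a hp ih =>
    have ha : a ≠ 0 := right_ne_zero_of_mul hn
    rw [liouville_mul hp.ne_zero ha, liouville_prime hp,
      ih ha fun r hr hra => h r hr (hra.mul_left p), Nat.cast_mul, jacobiSym.mul_left,
      h p hp (dvd_mul_right p a)]

/-- A function on `ℕ` that agrees at `n` and `n + q` for `n` up to `L` coprime to `q` is determined
by residues modulo `q` up to `L`. -/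
theorem eq_apply_mod_of_forall_apply_add {f : ℕ → ℤ} {q : ℕ} {L : ℝ} (hq : 1 < q)
    (hper : ∀ n : ℕ, 0 < n → (n : ℝ) ≤ L → n.Coprime q → f (n + q) = f n)
    {m : ℕ} (hmL : (m : ℝ) ≤ L) (hm : m.Coprime q) : f m = f (m % q) := by
  induction m using Nat.strong_induction_on with
  | _ m ih =>
    rcases lt_or_ge m q with hlt | hge
    · rw [Nat.mod_eq_of_lt hlt]
    · obtain ⟨k, rfl⟩ := Nat.exists_eq_add_of_le' hge
      have hk : k.Coprime q := by simpa using hm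
      have hk0 : 0 < k := by
        rcases Nat.eq_zero_or_pos k with rfl | h
        · simp at hk; omega
        · exact h
      have hkL : (k : ℝ) ≤ L := le_trans (by exact_mod_cast Nat.le_add_right k q) hmL
      rw [hper k hk0 hkL hk, ih k (by omega) hkL hk, Nat.add_mod_right]

open Classical in
/-- The integers `1 ≤ n ≤ q` coprime to `q` at which `λ` differs from the Jacobi symbol. -/
noncomputable def liouvilleDisagreement (q : ℕ) : Finset ℕ :=
  (Finset.Icc 1 q).filter (fun n => n.Coprime q ∧ liouville n ≠ jacobiSym (n : ℤ) q)

theorem mem_liouvilleDisagreement {q n : ℕ} :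
    n ∈ liouvilleDisagreement q ↔
      (1 ≤ n ∧ n ≤ q) ∧ n.Coprime q ∧ liouville n ≠ jacobiSym (n : ℤ) q := by
  simp [liouvilleDisagreement]

theorem liouville_mul_ne_jacobiSym_mul {q p n : ℕ} (hp : p.Prime) (hn : n ≠ 0)
    (hχ : jacobiSym p q = 1) (h : liouville n = jacobiSym n q) :
    liouville (p * n) ≠ jacobiSym ((p * n : ℕ) : ℤ) q := by
  rw [liouville_mul hp.ne_zero hn, liouville_prime hp, Nat.cast_mul, jacobiSym.mul_left, hχ, ← h]
  have := liouville_ne_zero n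
  omega

/-- A single split prime `p` with `p * q ≤ L` forces `λ` and the Jacobi symbol to disagree at half
of the residues. -/
theorem sub_one_le_two_mul_card_liouvilleDisagreement {q p : ℕ} {L : ℝ} (hq : q.Prime)
    (hper : ∀ n : ℕ, 0 < n → (n : ℝ) ≤ L → n.Coprime q → liouville (n + q) = liouville n)
    (hp : p.Prime) (hpq : p.Coprime q) (hpL : (p : ℝ) * q ≤ L) (hχ : jacobiSym p q = 1) :
    q - 1 ≤ 2 * (liouvilleDisagreement q).card := by
  classical
  set B := liouvilleDisagreement q
  have hcop {n : ℕ} (hn : n ∈ Finset.Ico 1 q) : n.Coprime q := by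
    rw [Finset.mem_Ico] at hn
    exact (Nat.coprime_of_lt_prime (by omega) hn.2 hq).symm
  have hcard : ((Finset.Ico 1 q).filter (· ∉ B)).card ≤ B.card := by
    refine Finset.card_le_card_of_injOn (fun n => p * n % q) ?_ ?_
    · intro n hn
      have hn' := Finset.mem_coe.1 hn
      rw [Finset.mem_filter] at hn'
      obtain ⟨hnI, hnB⟩ := hn'
      have hnq := hcop hnI
      rw [Finset.mem_Ico] at hnI
      have hgood : liouville n = jacobiSym n q := by
        by_contra h
        exact hnB (mem_liouvilleDisagreement.2 ⟨⟨hnI.1, hnI.2.le⟩, hnq, h⟩)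
      have hpn : (p * n).Coprime q := hpq.mul_left hnq
      have hmod : (p * n % q).Coprime q := by
        rwa [Nat.coprime_iff_gcd_eq_one, ← Nat.gcd_rec, Nat.gcd_comm]
      have hle : ((p * n : ℕ) : ℝ) ≤ L := by
        refine le_trans ?_ hpL
        exact_mod_cast Nat.mul_le_mul_left p hnI.2.le
      refine mem_liouvilleDisagreement.2
        ⟨⟨Nat.pos_of_ne_zero fun h => ?_, (Nat.mod_lt _ hq.pos).le⟩, hmod, ?_⟩
      · rw [show p * n % q = 0 from h, Nat.coprime_zero_left] at hmod
        exact hq.one_lt.ne' hmod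
      · rw [← eq_apply_mod_of_forall_apply_add hq.one_lt hper hle hpn, Int.natCast_mod,
          ← jacobiSym.mod_left]
        exact liouville_mul_ne_jacobiSym_mul hp (by omega) hχ hgood
    · intro a ha b hb hab
      simp only [Finset.coe_filter, Finset.mem_Ico, Set.mem_ofPred_eq] at ha hb
      have : a ≡ b [MOD q] := Nat.ModEq.cancel_left_of_coprime hpq.symm hab
      exact this.eq_of_lt_of_lt ha.1.2 hb.1.2
  have hsub : ((Finset.Ico 1 q).filter (· ∈ B)).card ≤ B.card :=
    Finset.card_le_card fun n hn => (Finset.mem_filter.1 hn).2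
  have hsplit := Finset.card_filter_add_card_filter_not (s := Finset.Ico 1 q) (· ∈ B)
  rw [Nat.card_Ico] at hsplit
  omega

/-- If no prime `p ≤ √q` splits, then the multiples `p * n ≤ q` of split primes `p` are distinct
and `λ` disagrees with the Jacobi symbol at each of them. -/
theorem card_mul_le_card_liouvilleDisagreement {q k : ℕ} {S : Finset ℕ} (hq : q.Prime)
    (hsmall : ∀ p : ℕ, p.Prime → p * p ≤ q → jacobiSym p q ≠ 1)
    (hS : ∀ p ∈ S, p.Prime ∧ p * k ≤ q ∧ jacobiSym p q = 1) :
    S.card * k ≤ (liouvilleDisagreement q).card := by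
  have hbig {p : ℕ} (hp : p ∈ S) : q < p * p := by
    by_contra! h
    exact hsmall p (hS p hp).1 h (hS p hp).2.2
  rw [← Nat.add_sub_cancel (n := k) (m := 1), ← Nat.card_Icc, ← Finset.card_product]
  refine Finset.card_le_card_of_injOn (fun x => x.1 * x.2) ?_ ?_
  · rintro ⟨p, n⟩ hx
    simp only [Finset.coe_product, Set.mem_prod, Finset.mem_coe, Finset.mem_Icc] at hx
    obtain ⟨hpS, hn1, hnk⟩ := hx
    obtain ⟨hp, hpk, hχ⟩ := hS p hpS
    have hpn : p * n ≤ q := (Nat.mul_le_mul_left p hnk).trans hpk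
    have hnq : n * n ≤ q := by
      have := hbig hpS
      have : n < p := by
        by_contra! h
        nlinarith
      nlinarith
    have hn_lt : n < q := by
      have := hp.two_le
      nlinarith
    have hpq : p.Coprime q := by
      rw [Nat.coprime_primes hp hq]
      rintro rfl
      simp [jacobiSym.mod_left (p : ℤ) p, jacobiSym.zero_left hp.one_lt] at hχ
    refine mem_liouvilleDisagreement.2 ⟨⟨Nat.mul_pos hp.pos hn1, hpn⟩,
      hpq.mul_left (Nat.coprime_of_lt_prime (by omega) hn_lt hq).symm, ?_⟩
    refine liouville_mul_ne_jacobiSym_mul hp (by omega) hχ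
      (liouville_eq_jacobiSym_of_forall_prime_dvd (by omega) fun r hr hrn => ?_)
    have hrn' : r ≤ n := Nat.le_of_dvd hn1 hrn
    have hrq : r.Coprime q :=
      (Nat.coprime_of_lt_prime hr.ne_zero (hrn'.trans_lt hn_lt) hq).symm
    exact (jacobiSym.eq_one_or_neg_one (by simpa using hrq)).resolve_left
      (hsmall r hr ((Nat.mul_le_mul hrn' hrn').trans hnq))
  · rintro ⟨p, n⟩ hx ⟨r, m⟩ hy hxy
    simp only [Finset.coe_product, Set.mem_prod, Finset.mem_coe, Finset.mem_Icc] at hx hy hxy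
    obtain ⟨hp, hpk, -⟩ := hS p hx.1
    obtain ⟨hr, hrk, -⟩ := hS r hy.1
    have hpn : p * n ≤ q := (Nat.mul_le_mul_left p hx.2.2).trans hpk
    have hpr : p = r := by
      by_contra hne
      have hdvd : p * r ∣ p * n :=
        ((Nat.coprime_primes hp hr).2 hne).mul_dvd_of_dvd_of_dvd (dvd_mul_right p n)
          (hxy ▸ dvd_mul_right r m)
      have hle := (Nat.le_of_dvd (Nat.mul_pos hp.pos hx.2.1) hdvd).trans hpn
      have := hbig hx.1
      have := hbig hy.1
      rcases le_total p r with h | h <;> nlinarith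
    subst hpr
    rw [Nat.eq_of_mul_eq_mul_left hp.pos hxy]

open Classical in
theorem few_split_primes_in_dyadic_ranges
    (δ : ℝ) (hδ : 0 < δ) (C : ℝ) (hC : 0 < C) :
    ∃ C' : ℝ, 0 < C' ∧ ∃ Q₀ : ℕ, ∀ q : ℕ, q.Prime → Q₀ ≤ q →
      ∀ L : ℝ, (q : ℝ) ^ ((3 : ℝ) / 2) ≤ L →
        (((Finset.Icc 1 q).filter
            (fun n => n.Coprime q ∧ liouville n ≠ jacobiSym (n : ℤ) q)).card : ℝ)
          ≤ C * (q : ℝ) ^ ((1 : ℝ) - δ) →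
        (∀ n : ℕ, 0 < n → (n : ℝ) ≤ L → n.Coprime q →
          liouville (n + q) = liouville n) →
        ∀ N : ℝ, 1 ≤ N → N ≤ (q : ℝ) →
          (((Finset.range (q + 1)).filter
              (fun p : ℕ => p.Prime ∧ N / 2 ≤ (p : ℝ) ∧ (p : ℝ) ≤ N ∧
                jacobiSym (p : ℤ) q = 1)).card : ℝ)
            ≤ C' * N * (q : ℝ) ^ (-(3 * δ / 4)) := by
  obtain ⟨Q₀, hQ₀⟩ := Filter.eventually_atTop.1
    (((tendsto_rpow_atTop hδ).comp tendsto_natCast_atTop_atTop).eventually_gt_atTop (4 * C))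
  refine ⟨2 * C, by positivity, Q₀, fun q hq hQq L hL hB hper N hN1 hNq => ?_⟩
  change ((liouvilleDisagreement q).card : ℝ) ≤ _ at hB
  have hq2 : (2 : ℝ) ≤ q := by exact_mod_cast hq.two_le
  have hq0 : (0 : ℝ) < q := by linarith
  have hqδ : 4 * C < (q : ℝ) ^ δ := hQ₀ q hQq
  rw [Real.rpow_sub hq0, Real.rpow_one] at hB
  have hsmall (p : ℕ) (hp : p.Prime) (hpp : p * p ≤ q) : jacobiSym p q ≠ 1 := by
    intro hχ
    have hp2 := hp.two_le
    have hpq : p.Coprime q :=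
      (Nat.coprime_of_lt_prime hp.ne_zero (by nlinarith) hq).symm
    have hsqrt : (p : ℝ) ≤ (q : ℝ) ^ ((1 : ℝ) / 2) := by
      rw [← Real.sqrt_eq_rpow]
      exact Real.le_sqrt_of_sq_le (by rw [sq]; exact_mod_cast hpp)
    have hpL : (p : ℝ) * q ≤ L := by
      refine le_trans ?_ hL
      rw [show (3 : ℝ) / 2 = 1 / 2 + 1 by norm_num, Real.rpow_add hq0, Real.rpow_one]
      gcongr
    have hcard := sub_one_le_two_mul_card_liouvilleDisagreement hq hper hp hpq hpL hχ
    have hcard' : (q : ℝ) ≤ 2 * (liouvilleDisagreement q).card + 1 := by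
      exact_mod_cast Nat.sub_le_iff_le_add.1 hcard
    have hlt : C * (q / (q : ℝ) ^ δ) < q / 4 := by
      rw [← mul_div_assoc, div_lt_div_iff₀ (by positivity) (by norm_num)]
      nlinarith
    linarith
  set S := (Finset.range (q + 1)).filter (fun p : ℕ => p.Prime ∧ N / 2 ≤ (p : ℝ) ∧ (p : ℝ) ≤ N ∧
    jacobiSym (p : ℤ) q = 1) with hSdef
  have hS := card_mul_le_card_liouvilleDisagreement (k := ⌊q / N⌋₊) (S := S) hq hsmall (by
    intro p hp
    rw [hSdef, Finset.mem_filter] at hp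
    obtain ⟨-, hp, -, hpN, hχ⟩ := hp
    refine ⟨hp, ?_, hχ⟩
    have : (p : ℝ) * ⌊q / N⌋₊ ≤ q := calc
      (p : ℝ) * ⌊q / N⌋₊ ≤ N * (q / N) := by
        gcongr
        exact Nat.floor_le (by positivity)
      _ = q := by field_simp
    exact_mod_cast this)
  have hS' : (S.card : ℝ) * ⌊q / N⌋₊ ≤ C * (q / (q : ℝ) ^ δ) := le_trans (by exact_mod_cast hS) hB
  have hfloor : q / (2 * N) ≤ (⌊q / N⌋₊ : ℝ) := by
    have h1 : 1 ≤ q / N := (one_le_div (by linarith)).2 hNq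
    have h2 : (1 : ℝ) ≤ ⌊q / N⌋₊ := by exact_mod_cast Nat.le_floor (by simpa using h1)
    have h3 := Nat.lt_floor_add_one (q / N)
    have h4 : q / (2 * N) = q / N / 2 := by field_simp
    linarith
  have hfin : (S.card : ℝ) * (q / (2 * N)) ≤ C * (q / (q : ℝ) ^ δ) :=
    le_trans (by gcongr) hS'
  calc (S.card : ℝ) = S.card * (q / (2 * N)) * (2 * N / q) := by field_simp
    _ ≤ C * (q / (q : ℝ) ^ δ) * (2 * N / q) := by gcongr
    _ = 2 * C * N * (q : ℝ) ^ (-δ) := by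
      rw [Real.rpow_neg hq0.le]
      field_simp
    _ ≤ 2 * C * N * (q : ℝ) ^ (-(3 * δ / 4)) := by
      gcongr
      · linarith
      · linarith
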